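/- arXiv:1902.05813 — 3 statements merged into one kernel-verified Lean document; each statement's English description precedes it below -/
import Mathlib

section
/- Knight's identity: for every τ ∈ (0,1), every x ∈ ℝ with x ≠ 0, and every y ∈ ℝ, one has ρ_τ(x−y) − ρ_τ(x) = −y·ψ_τ(x) + y·∫₀¹ [1{x ≤ y·s} − 1{x ≤ 0}] ds, and moreover y·∫₀¹ [1{x ≤ y·s} − 1{x ≤ 0}] ds = (x−y)·[1{y < x < 0} − 1{0 < x < y}]. -/
/-- The check function `ρ_τ(x) = x (τ - 1{x<0})`. -/
noncomputable def rho (τ x : ℝ) : ℝ := x * (τ - if x < 0 then 1 else 0)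

/-- The quantile score `ψ_τ(x) = τ - 1{x<0}`. -/
noncomputable def psi (τ x : ℝ) : ℝ := τ - if x < 0 then 1 else 0

open MeasureTheory in
/-- The integral over `[a, b]` of a function that equals `u` on `(a, c)` and `v` on `(c, b)`. -/
lemma intervalIntegral_of_eqOn_Ioo {f : ℝ → ℝ} {a b c u v : ℝ} (hac : a ≤ c) (hcb : c ≤ b)
    (hu : ∀ s ∈ Set.Ioo a c, f s = u) (hv : ∀ s ∈ Set.Ioo c b, f s = v) :
    ∫ s in a..b, f s = (c - a) * u + (b - c) * v := by
  have integrable_and_eq : ∀ {p q w : ℝ}, p ≤ q → (∀ s ∈ Set.Ioo p q, f s = w) →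
      IntervalIntegrable f volume p q ∧ ∫ s in p..q, f s = (q - p) * w := by
    intro p q w hpq hw
    have hEq : Set.EqOn (fun _ => w) f (Set.Ioo p q) := fun s hs => (hw s hs).symm
    refine ⟨intervalIntegrable_const.congr_uIoo (Set.uIoo_of_le hpq ▸ hEq), ?_⟩
    rw [← intervalIntegral.integral_congr_Ioo_of_le hpq hEq, intervalIntegral.integral_const,
      smul_eq_mul]
  obtain ⟨hi₁, he₁⟩ := integrable_and_eq hac hu
  obtain ⟨hi₂, he₂⟩ := integrable_and_eq hcb hv
  rw [← intervalIntegral.integral_add_adjacent_intervals hi₁ hi₂, he₁, he₂]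

/-- The second form of the remainder term in Knight's identity. -/
lemma mul_integral_indicator_sub_indicator {x : ℝ} (y : ℝ) (hx : x ≠ 0) :
    y * (∫ s in (0:ℝ)..1,
            ((if x ≤ y * s then (1:ℝ) else 0) - (if x ≤ 0 then (1:ℝ) else 0)))
      = (x - y) * ((if y < x ∧ x < 0 then (1:ℝ) else 0)
          - (if 0 < x ∧ x < y then (1:ℝ) else 0)) := by
  rcases lt_or_gt_of_ne hx with hx | hx
  · by_cases hxy : y < x
    · have hy : y < 0 := hxy.trans hx
      rw [intervalIntegral_of_eqOn_Ioo (c := x / y) (u := 0) (v := -1)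
        (div_nonneg_of_nonpos hx.le hy.le) ((div_le_one_of_neg hy).2 hxy.le)]
      · simp only [hx, hxy, hx.not_gt, and_self, false_and, if_true, if_false]
        field_simp [hy.ne]
        ring
      · intro s hs
        have : x < y * s := by
          have := (lt_div_iff_of_neg hy).1 hs.2
          linarith
        simp [this.le, hx.le]
      · intro s hs
        have : y * s < x := by
          have := (div_lt_iff_of_neg hy).1 hs.1
          linarith
        simp [this.not_ge, hx.le]
    · rw [intervalIntegral_of_eqOn_Ioo (c := 1) (u := 0) (v := 0) zero_le_one le_rfl]
      · simp [hxy, hx.not_gt]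
      · intro s hs
        have : x ≤ y * s := by nlinarith [hs.1, hs.2]
        simp [this, hx.le]
      · simp
  · by_cases hxy : x < y
    · have hy : 0 < y := hx.trans hxy
      rw [intervalIntegral_of_eqOn_Ioo (c := x / y) (u := 0) (v := 1)
        (div_nonneg hx.le hy.le) ((div_le_one hy).2 hxy.le)]
      · simp only [hx, hxy, hx.not_gt, and_self, and_false, if_true, if_false]
        field_simp [hy.ne']
        ring
      · intro s hs
        have : y * s < x := by
          have := (lt_div_iff₀ hy).1 hs.2
          linarith
        simp [this.not_ge, hx.not_ge]
      · intro s hs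
        have : x < y * s := by
          have := (div_lt_iff₀ hy).1 hs.1
          linarith
        simp [this.le, hx.not_ge]
    · rw [intervalIntegral_of_eqOn_Ioo (c := 1) (u := 0) (v := 0) zero_le_one le_rfl]
      · simp [hxy, hx.not_gt]
      · intro s hs
        have : y * s < x := by nlinarith [hs.1, hs.2]
        simp [this.not_ge, hx.not_ge]
      · simp

/-- Knight's identity: for `τ ∈ (0,1)`, `x ≠ 0` and any `y`,
`ρ_τ(x−y) − ρ_τ(x) = −y ψ_τ(x) + y ∫₀¹ (1{x ≤ ys} − 1{x ≤ 0}) ds`, and moreover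
`y ∫₀¹ (1{x ≤ ys} − 1{x ≤ 0}) ds = (x−y) (1{y < x < 0} − 1{0 < x < y})`. -/
theorem knight_identity (τ x y : ℝ) (hτ : τ ∈ Set.Ioo (0:ℝ) 1) (hx : x ≠ 0) :
    (rho τ (x - y) - rho τ x
      = -y * psi τ x
        + y * ∫ s in (0:ℝ)..1,
            ((if x ≤ y * s then (1:ℝ) else 0) - (if x ≤ 0 then (1:ℝ) else 0))) ∧
    (y * (∫ s in (0:ℝ)..1,
            ((if x ≤ y * s then (1:ℝ) else 0) - (if x ≤ 0 then (1:ℝ) else 0)))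
      = (x - y) * ((if y < x ∧ x < 0 then (1:ℝ) else 0)
          - (if 0 < x ∧ x < y then (1:ℝ) else 0))) := by
  refine ⟨?_, mul_integral_indicator_sub_indicator y hx⟩
  rw [mul_integral_indicator_sub_indicator y hx]
  unfold rho psi
  rcases lt_or_gt_of_ne hx with hx | hx
  · rcases lt_or_ge y x with hxy | hxy
    · simp only [sub_neg, hx, hxy, hx.not_gt, hxy.not_gt, and_self, if_true, if_false]
      ring
    · rcases hxy.eq_or_lt with rfl | hxy
      · simp [hx]
      · simp only [sub_neg, hx, hxy, hx.not_gt, hxy.not_gt, and_true, if_true, if_false]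
        ring
  · rcases lt_or_ge x y with hxy | hxy
    · simp only [sub_neg, hx, hxy, hx.not_gt, hxy.not_gt, and_self, if_true, if_false]
      ring
    · simp only [sub_neg, hx, hxy.not_gt, hx.not_gt, and_false, if_false]
      ring
end

section
/- Pointwise drift bound: for every κ with 0 < κ ≤ 1, all real numbers φ₁,…,φ_p, β₁,…,β_p, b, and x₁,…,x_p, one has |Σ_{i=1}^p φ_i x_i + S_Q(b + Σ_{i=1}^p β_i x_i²)|^κ ≤ Σ_{i=1}^p max{|φ_i − √|β_i||, |φ_i + √|β_i||}^κ · |x_i|^κ + |b|^{κ/2}. -/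
/-- The transformation `S_Q(x) = √|x| · sgn(x)`. -/
noncomputable def SQ (x : ℝ) : ℝ := Real.sqrt |x| * Real.sign x

theorem abs_SQ_le (y : ℝ) : |SQ y| ≤ √|y| := by
  rw [SQ, abs_mul, abs_of_nonneg (Real.sqrt_nonneg _)]
  refine mul_le_of_le_one_right (Real.sqrt_nonneg _) ?_
  rcases Real.sign_apply_eq y with h | h | h <;> simp [h]

theorem Real.rpow_sum_le_sum_rpow {ι : Type*} (s : Finset ι) {f : ι → ℝ}
    (hf : ∀ i ∈ s, 0 ≤ f i) {κ : ℝ} (hκ0 : 0 < κ) (hκ1 : κ ≤ 1) :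
    (∑ i ∈ s, f i) ^ κ ≤ ∑ i ∈ s, f i ^ κ :=
  Finset.le_sum_of_subadditive_on_pred (fun y : ℝ => y ^ κ) (fun y => 0 ≤ y)
    (Real.zero_rpow hκ0.ne').le
    (fun _ _ ha hb => Real.rpow_add_le_add_rpow ha hb hκ0.le hκ1)
    (fun _ _ => add_nonneg) f hf

theorem Real.sqrt_add_le_sqrt_add_sqrt {a b : ℝ} (ha : 0 ≤ a) (hb : 0 ≤ b) :
    √(a + b) ≤ √a + √b := by
  simpa only [Real.sqrt_eq_rpow] using
    Real.rpow_add_le_add_rpow ha hb (by norm_num : (0 : ℝ) ≤ 1 / 2) (by norm_num)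

theorem Real.sqrt_sum_le_sum_sqrt {ι : Type*} (s : Finset ι) {f : ι → ℝ}
    (hf : ∀ i ∈ s, 0 ≤ f i) : √(∑ i ∈ s, f i) ≤ ∑ i ∈ s, √(f i) := by
  simpa only [Real.sqrt_eq_rpow] using
    Real.rpow_sum_le_sum_rpow s hf (by norm_num : (0 : ℝ) < 1 / 2) (by norm_num)

theorem abs_add_abs_le_max_abs_sub_abs_add (a c : ℝ) :
    |a| + |c| ≤ max |a - c| |a + c| := by
  rcases abs_cases a with h | h <;> rcases abs_cases c with h' | h' <;>
    rcases abs_cases (a - c) with h1 | h1 <;> rcases abs_cases (a + c) with h2 | h2 <;>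
    first
      | exact le_max_of_le_left (by linarith)
      | exact le_max_of_le_right (by linarith)

theorem abs_drift_le {ι : Type*} (s : Finset ι) (φ β x : ι → ℝ) (b : ℝ) :
    |∑ i ∈ s, φ i * x i + SQ (b + ∑ i ∈ s, β i * x i ^ 2)|
      ≤ ∑ i ∈ s, max |φ i - (√|β i|)| |φ i + (√|β i|)| * |x i| + √|b| := by
  have hSQ : |SQ (b + ∑ i ∈ s, β i * x i ^ 2)| ≤ √|b| + ∑ i ∈ s, √|β i| * |x i| := by
    calc |SQ (b + ∑ i ∈ s, β i * x i ^ 2)|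
        ≤ √|b + ∑ i ∈ s, β i * x i ^ 2| := abs_SQ_le _
      _ ≤ √(|b| + ∑ i ∈ s, |β i * x i ^ 2|) := by
          gcongr
          exact (abs_add_le _ _).trans (by gcongr; exact Finset.abs_sum_le_sum_abs _ _)
      _ ≤ √|b| + √(∑ i ∈ s, |β i * x i ^ 2|) :=
          Real.sqrt_add_le_sqrt_add_sqrt (abs_nonneg _)
            (Finset.sum_nonneg fun i _ => abs_nonneg _)
      _ ≤ √|b| + ∑ i ∈ s, √|β i * x i ^ 2| := by
          gcongr
          exact Real.sqrt_sum_le_sum_sqrt s fun i _ => abs_nonneg _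
      _ = √|b| + ∑ i ∈ s, √|β i| * |x i| := by
          simp only [abs_mul, Real.sqrt_mul (abs_nonneg _), abs_pow,
            Real.sqrt_sq (abs_nonneg _)]
  have hlin : |∑ i ∈ s, φ i * x i| ≤ ∑ i ∈ s, |φ i| * |x i| := by
    simpa only [abs_mul] using Finset.abs_sum_le_sum_abs (fun i => φ i * x i) s
  have hmax : ∑ i ∈ s, |φ i| * |x i| + ∑ i ∈ s, √|β i| * |x i|
      ≤ ∑ i ∈ s, max |φ i - (√|β i|)| |φ i + (√|β i|)| * |x i| := by
    rw [← Finset.sum_add_distrib]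
    refine Finset.sum_le_sum fun i _ => ?_
    rw [← add_mul]
    gcongr
    simpa only [abs_of_nonneg (Real.sqrt_nonneg |β i|)] using
      abs_add_abs_le_max_abs_sub_abs_add (φ i) √|β i|
  linarith [abs_add_le (∑ i ∈ s, φ i * x i) (SQ (b + ∑ i ∈ s, β i * x i ^ 2))]

/-- Pointwise drift bound: for `0 < κ ≤ 1` and any reals `φ_i, β_i, b, x_i`,
`|Σ φ_i x_i + S_Q(b + Σ β_i x_i²)|^κ
  ≤ Σ max{|φ_i − √|β_i||, |φ_i + √|β_i||}^κ |x_i|^κ + |b|^{κ/2}`. -/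
theorem pointwise_drift_bound (p : ℕ) (hp : 0 < p) (κ : ℝ) (hκ0 : 0 < κ)
    (hκ1 : κ ≤ 1) (φ β : Fin p → ℝ) (b : ℝ) (x : Fin p → ℝ) :
    |∑ i, φ i * x i + SQ (b + ∑ i, β i * (x i) ^ 2)| ^ κ
      ≤ (∑ i, (max (abs (φ i - Real.sqrt |β i|)) (abs (φ i + Real.sqrt |β i|))) ^ κ
            * |x i| ^ κ)
        + |b| ^ (κ / 2) := by
  have hmax (i : Fin p) : 0 ≤ max |φ i - (√|β i|)| |φ i + (√|β i|)| :=
    (abs_nonneg _).trans (le_max_left _ _)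
  have hterm (i : Fin p) : 0 ≤ max |φ i - (√|β i|)| |φ i + (√|β i|)| * |x i| :=
    mul_nonneg (hmax i) (abs_nonneg _)
  calc |∑ i, φ i * x i + SQ (b + ∑ i, β i * (x i) ^ 2)| ^ κ
      ≤ (∑ i, max |φ i - (√|β i|)| |φ i + (√|β i|)| * |x i| + √|b|) ^ κ := by
        gcongr
        exact abs_drift_le _ φ β x b
    _ ≤ (∑ i, max |φ i - (√|β i|)| |φ i + (√|β i|)| * |x i|) ^ κ + √|b| ^ κ :=
        Real.rpow_add_le_add_rpow (Finset.sum_nonneg fun i _ => hterm i)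
          (Real.sqrt_nonneg _) hκ0.le hκ1
    _ ≤ ∑ i, (max |φ i - (√|β i|)| |φ i + (√|β i|)| * |x i|) ^ κ + √|b| ^ κ := by
        gcongr
        exact Real.rpow_sum_le_sum_rpow _ (fun i _ => hterm i) hκ0 hκ1
    _ = _ := by
        simp only [Real.mul_rpow (hmax _) (abs_nonneg _)]
        rw [Real.sqrt_eq_rpow, ← Real.rpow_mul (abs_nonneg b), one_div_mul_eq_div]
end

section
/- Existence of interpolating drift constants: let p ≥ 2 be an integer and a₁,…,a_p ≥ 0 real numbers with Σ_{i=1}^p a_i < 1. Then there exist positive real numbers r₁,…,r_{p−1} such that a_p < r_{p−1} < 1 − Σ_{i=1}^{p−1} a_i, and a_{i+1} + r_{i+1} < r_i < 1 − Σ_{k=1}^i a_k for all 1 ≤ i ≤ p−2; moreover, for any such choice, ρ := max{a₁ + r₁, (a₂ + r₂)/r₁, …, (a_{p−1} + r_{p−1})/r_{p−2}, a_p/r_{p−1}} < 1. -/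
/-- Existence of interpolating drift constants, and the resulting contraction
factor `ρ = max{a₁ + r₁, (a₂ + r₂)/r₁, …, (a_{p−1} + r_{p−1})/r_{p−2}, a_p/r_{p−1}}`
is strictly less than one. -/
theorem exists_interpolating_drift_constants (p : ℕ) (hp : 2 ≤ p) (a : ℕ → ℝ)
    (ha : ∀ i ∈ Finset.Icc 1 p, 0 ≤ a i)
    (hsum : ∑ i ∈ Finset.Icc 1 p, a i < 1) :
    (∃ r : ℕ → ℝ,
      (∀ i ∈ Finset.Icc 1 (p - 1), 0 < r i) ∧
      a p < r (p - 1) ∧ r (p - 1) < 1 - ∑ i ∈ Finset.Icc 1 (p - 1), a i ∧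
      (∀ i ∈ Finset.Icc 1 (p - 2),
        a (i + 1) + r (i + 1) < r i ∧ r i < 1 - ∑ k ∈ Finset.Icc 1 i, a k)) ∧
    (∀ r : ℕ → ℝ,
      (∀ i ∈ Finset.Icc 1 (p - 1), 0 < r i) →
      a p < r (p - 1) → r (p - 1) < 1 - ∑ i ∈ Finset.Icc 1 (p - 1), a i →
      (∀ i ∈ Finset.Icc 1 (p - 2),
        a (i + 1) + r (i + 1) < r i ∧ r i < 1 - ∑ k ∈ Finset.Icc 1 i, a k) →
      (Finset.Icc 1 (p - 2)).fold max (max (a 1 + r 1) (a p / r (p - 1)))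
          (fun i => (a (i + 1) + r (i + 1)) / r i) < 1) := by
  obtain ⟨q, rfl⟩ : ∃ q, p = q + 2 := ⟨p - 2, by omega⟩
  rw [show q + 2 - 1 = q + 1 by omega, show q + 2 - 2 = q by omega]
  constructor
  · have hS (n : ℕ) : ∑ k ∈ Finset.Icc 1 (n + 1), a k = ∑ k ∈ Finset.Icc 1 n, a k + a (n + 1) :=
      Finset.sum_Icc_succ_top (by omega) _
    have hle (i : ℕ) (hi : i ≤ q + 2) :
        ∑ k ∈ Finset.Icc 1 i, a k ≤ ∑ k ∈ Finset.Icc 1 (q + 2), a k :=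
      Finset.sum_le_sum_of_subset_of_nonneg (Finset.Icc_subset_Icc_right hi)
        fun k hk _ => ha k hk
    set S : ℕ → ℝ := fun n => ∑ k ∈ Finset.Icc 1 n, a k
    obtain ⟨ε, hε, hεd⟩ : ∃ ε : ℝ, 0 < ε ∧ ε * (q + 2) = 1 - S (q + 2) :=
      ⟨(1 - S (q + 2)) / (q + 2), div_pos (sub_pos.2 hsum) (by positivity),
        div_mul_cancel₀ _ (by positivity)⟩
    have hlt (i : ℕ) (hi : 1 ≤ i) :
        S (q + 2) - S i + ε * (q + 2 - i) < 1 - S i := by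
      have : (1 : ℝ) ≤ i := by exact_mod_cast hi
      nlinarith
    refine ⟨fun i => S (q + 2) - S i + ε * (q + 2 - i), fun i hi => ?_, ?_,
      hlt (q + 1) (by omega), fun i hi => ⟨?_, hlt i (Finset.mem_Icc.1 hi).1⟩⟩
    · have hi' := (Finset.mem_Icc.1 hi).2
      have h : (i : ℝ) ≤ q + 1 := by exact_mod_cast hi'
      have := hle i (by omega)
      have : 0 < ε * (q + 2 - i) := mul_pos hε (by linarith)
      change 0 < S (q + 2) - S i + ε * (q + 2 - i)
      linarith
    · have := hS (q + 1)
      change a (q + 2) < S (q + 2) - S (q + 1) + ε * (q + 2 - (q + 1 : ℕ))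
      change S (q + 2) = S (q + 1) + a (q + 2) at this
      push_cast
      linarith
    · have := hS i
      change S (i + 1) = S i + a (i + 1) at this
      change a (i + 1) + (S (q + 2) - S (i + 1) + ε * (q + 2 - (i + 1 : ℕ))) <
        S (q + 2) - S i + ε * (q + 2 - i)
      push_cast
      linarith
  · intro r hr hlast hlast' hmid
    refine (Finset.fold_max_lt _).2 ⟨max_lt ?_ ?_, fun i hi => ?_⟩
    · have h1 : r 1 < 1 - ∑ k ∈ Finset.Icc 1 1, a k := by
        rcases Nat.eq_zero_or_pos q with rfl | hq
        · exact hlast'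
        · exact (hmid 1 (Finset.mem_Icc.2 ⟨le_rfl, hq⟩)).2
      rw [Finset.Icc_self, Finset.sum_singleton] at h1
      linarith
    · exact (div_lt_one (hr _ (Finset.mem_Icc.2 ⟨by omega, le_rfl⟩))).2 hlast
    · have hi' := Finset.mem_Icc.1 hi
      exact (div_lt_one (hr i (Finset.mem_Icc.2 ⟨hi'.1, by omega⟩))).2 (hmid i hi).1
end
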